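/- Let ≺ be a graded monomial order on S and let r_0 = reg(H_I^a). There exists g ∈ KΔ_≺(I) such that C_X(r_0 − 1)^⊥ = K·(g(P_1),…,g(P_m)) and g(P_i) ≠ 0 for all i, if and only if H_I^a(r_0 − 1) + 1 = |X| and v_{𝔭_i}(I) = r_0 for all i. -/

import Mathlib

open MvPolynomial

noncomputable section

variable {K : Type*} [Field K] {s m : ℕ}

/-- Evaluation linear map at a family of points. -/
def evalMap (P : Fin m → (Fin s → K)) :
    MvPolynomial (Fin s) K →ₗ[K] (Fin m → K) :=
  LinearMap.pi fun i => (MvPolynomial.aeval (P i)).toLinearMap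

/-- Vanishing ideal of a finite family of points. -/
def vanishingIdeal (P : Fin m → (Fin s → K)) : Ideal (MvPolynomial (Fin s) K) :=
  ⨅ i, RingHom.ker (MvPolynomial.eval (P i))

/-- The linear map `φ : f ↦ ∑ i, f(P i)`. -/
def sumEval (P : Fin m → (Fin s → K)) : MvPolynomial (Fin s) K →ₗ[K] K :=
  ∑ i, (MvPolynomial.aeval (P i)).toLinearMap

/-- The leading exponent (initial monomial exponent) of a polynomial w.r.t. a monomial order. -/
def leadExpo (mo : MonomialOrder (Fin s)) (f : MvPolynomial (Fin s) K) : Fin s →₀ ℕ :=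
  mo.toSyn.symm (f.support.sup fun a => mo.toSyn a)

/-- The initial ideal of `I` w.r.t. a monomial order. -/
def initialIdeal (mo : MonomialOrder (Fin s)) (I : Ideal (MvPolynomial (Fin s) K)) :
    Ideal (MvPolynomial (Fin s) K) :=
  Ideal.span ((fun f => (monomial (leadExpo mo f) (1 : K))) '' {f | f ∈ I ∧ f ≠ 0})

/-- The set of exponents of standard monomials of `S/I`. -/
def stdMon (mo : MonomialOrder (Fin s)) (I : Ideal (MvPolynomial (Fin s) K)) :
    Set (Fin s →₀ ℕ) :=
  {a | monomial a (1 : K) ∉ initialIdeal mo I}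

/-- `K Δ_≺(I)`, the span of the standard monomials. -/
def stdSpan (mo : MonomialOrder (Fin s)) (I : Ideal (MvPolynomial (Fin s) K)) :
    Submodule K (MvPolynomial (Fin s) K) :=
  Submodule.span K ((fun a => monomial a (1 : K)) '' stdMon mo I)

/-- The space `(ker φ : L) = {g | g·f ∈ ker φ for all f ∈ L}`. -/
def colonKer (φ : MvPolynomial (Fin s) K →ₗ[K] K)
    (L : Submodule K (MvPolynomial (Fin s) K)) : Submodule K (MvPolynomial (Fin s) K) where
  carrier := {g | ∀ f ∈ L, φ (g * f) = 0}
  add_mem' := fun ha hb f hf => by rw [add_mul, map_add, ha f hf, hb f hf, add_zero]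
  zero_mem' := fun f hf => by rw [zero_mul, map_zero]
  smul_mem' := fun c a ha f hf => by rw [smul_mul_assoc, map_smul, ha f hf, smul_zero]

/-- The algebraic dual `L^⊥ = (ker φ : L) ∩ KΔ_≺(I)`. -/
def algDual (P : Fin m → (Fin s → K)) (mo : MonomialOrder (Fin s))
    (L : Submodule K (MvPolynomial (Fin s) K)) : Submodule K (MvPolynomial (Fin s) K) :=
  colonKer (sumEval P) L ⊓ stdSpan mo (vanishingIdeal P)

/-- The dual of a linear code in `K^m`. -/
def dualCode (C : Submodule K (Fin m → K)) : Submodule K (Fin m → K) where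
  carrier := {α | ∀ β ∈ C, ∑ i, α i * β i = 0}
  add_mem' := fun ha hb β hβ => by
    simp only [Pi.add_apply, add_mul, Finset.sum_add_distrib]
    rw [ha β hβ, hb β hβ, add_zero]
  zero_mem' := fun β hβ => by simp
  smul_mem' := fun c a ha β hβ => by
    simp only [Pi.smul_apply, smul_eq_mul, mul_assoc, ← Finset.mul_sum]
    rw [ha β hβ, mul_zero]

/-- Coordinatewise scaling of `K^m` by a vector `β`. -/
def scaleMap (β : Fin m → K) : (Fin m → K) →ₗ[K] (Fin m → K) :=
  LinearMap.pi fun i => β i • LinearMap.proj i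

/-- A monomial order is graded if it refines total degree. -/
def MonomialOrder.IsGraded (mo : MonomialOrder (Fin s)) : Prop :=
  ∀ a b : Fin s →₀ ℕ, Finsupp.degree a < Finsupp.degree b → mo.toSyn a < mo.toSyn b

/-- The affine Hilbert function of the vanishing ideal of the points `P`. -/
def hilbA (P : Fin m → (Fin s → K)) (d : ℕ) : ℕ :=
  Module.finrank K
    (Submodule.map (Ideal.Quotient.mkₐ K (vanishingIdeal P)).toLinearMap
      (restrictTotalDegree (Fin s) K d))

/-- The affine Hilbert function, with `H(d) = 0` for `d < 0`. -/
def hilbAZ (P : Fin m → (Fin s → K)) (d : ℤ) : ℕ :=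
  if d < 0 then 0 else hilbA P d.toNat

/-- The Reed–Muller-type code of degree `d` on the points `P`. -/
def RMcode (P : Fin m → (Fin s → K)) (d : ℕ) : Submodule K (Fin m → K) :=
  Submodule.map (evalMap P) (restrictTotalDegree (Fin s) K d)

/-- The Reed–Muller-type code indexed by an integer degree, `⊥` for `d < 0`. -/
def RMcodeZ (P : Fin m → (Fin s → K)) (d : ℤ) : Submodule K (Fin m → K) :=
  if d < 0 then ⊥ else RMcode P d.toNat

/-- The vanishing ideal of a single point. -/
def pointIdeal (Q : Fin s → K) : Ideal (MvPolynomial (Fin s) K) :=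
  RingHom.ker (MvPolynomial.eval Q)

/-- The local v-number `v_𝔭(I)`. -/
def vNumAt (I 𝔭 : Ideal (MvPolynomial (Fin s) K)) : ℕ :=
  sInf {d | ∃ f : MvPolynomial (Fin s) K, f ≠ 0 ∧ f.totalDegree = d ∧
    I.colon (Ideal.span {f}) = 𝔭}

/-- `f` is an indicator function for the `i`-th point. -/
def IsIndicator (P : Fin m → (Fin s → K)) (f : MvPolynomial (Fin s) K) (i : Fin m) : Prop :=
  MvPolynomial.eval (P i) f ≠ 0 ∧ ∀ j, j ≠ i → MvPolynomial.eval (P j) f = 0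

/-- The minimum distance of a linear code. -/
def minDist (C : Submodule K (Fin m → K)) : ℕ :=
  sInf {w | ∃ v ∈ C, v ≠ 0 ∧ Set.ncard {i | v i ≠ 0} = w}

theorem mem_vanishingIdeal_iff_eval_eq_zero (P : Fin m → (Fin s → K)) (f : MvPolynomial (Fin s) K) :
    f ∈ vanishingIdeal P ↔ ∀ i, eval (P i) f = 0 := by
  simp [_root_.vanishingIdeal]

theorem evalMap_apply (P : Fin m → (Fin s → K)) (f : MvPolynomial (Fin s) K) (i : Fin m) :
    evalMap P f i = eval (P i) f := by
  simp [evalMap, aeval_eq_eval]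

theorem hilbA_eq_finrank_RMcode (P : Fin m → (Fin s → K)) (d : ℕ) :
    hilbA P d = Module.finrank K (RMcode P d) := by
  have hker : (vanishingIdeal P).restrictScalars K = LinearMap.ker (evalMap P) := by
    ext f
    simp [mem_vanishingIdeal_iff_eval_eq_zero, _root_.funext_iff, evalMap_apply]
  let e : (MvPolynomial (Fin s) K ⧸ vanishingIdeal P) →ₗ[K] (Fin m → K) :=
    ((vanishingIdeal P).restrictScalars K).liftQ (evalMap P) hker.le
  have he : Function.Injective e := by
    rw [← LinearMap.ker_eq_bot]
    exact Submodule.ker_liftQ_eq_bot _ _ _ hker.ge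
  have hmap : RMcode P d = (Submodule.map (Ideal.Quotient.mkₐ K (vanishingIdeal P)).toLinearMap
      (restrictTotalDegree (Fin s) K d)).map e := by
    rw [← Submodule.map_comp]
    rfl
  rw [hmap]
  exact (Submodule.equivMapOfInjective e he _).finrank_eq

theorem single_mem_RMcode_iff (P : Fin m → (Fin s → K)) (d : ℕ) (i : Fin m) :
    Pi.single i 1 ∈ RMcode P d ↔
      ∃ f : MvPolynomial (Fin s) K, f.totalDegree ≤ d ∧ IsIndicator P f i := by
  constructor
  · rintro ⟨f, hf, hfi⟩
    have hval : ∀ j, eval (P j) f = (Pi.single i 1 : Fin m → K) j := fun j => by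
      rw [← hfi, evalMap_apply]
    refine ⟨f, (mem_restrictTotalDegree _ _ _).1 hf, by simp [hval], fun j hj => ?_⟩
    simp [hval, hj]
  · rintro ⟨f, hf, hfi, hfj⟩
    have hfmem : evalMap P f ∈ RMcode P d := ⟨f, (mem_restrictTotalDegree _ _ _).2 hf, rfl⟩
    convert (RMcode P d).smul_mem (eval (P i) f)⁻¹ hfmem using 1
    ext j
    rcases eq_or_ne j i with rfl | hj
    · simp [evalMap_apply, hfi]
    · simp [evalMap_apply, hfj j hj, hj]

theorem colon_eq_pointIdeal_iff {P : Fin m → (Fin s → K)} (hP : Function.Injective P)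
    (f : MvPolynomial (Fin s) K) (i : Fin m) :
    (vanishingIdeal P).colon (Ideal.span {f}) = pointIdeal (P i) ↔ IsIndicator P f i := by
  have hcolon : ∀ g, g ∈ (vanishingIdeal P).colon (Ideal.span {f}) ↔
      ∀ j, eval (P j) g = 0 ∨ eval (P j) f = 0 := fun g => by
    simp [mem_vanishingIdeal_iff_eval_eq_zero]
  have hpoint : ∀ g, g ∈ pointIdeal (P i) ↔ eval (P i) g = 0 := fun _ => Iff.rfl
  constructor
  · intro h
    have hfj : ∀ j, j ≠ i → eval (P j) f = 0 := by
      intro j hj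
      by_contra hne
      refine hj (hP (funext fun k => ?_))
      have hmem : X k - C (P i k) ∈ pointIdeal (P i) := by simp [hpoint]
      rw [← h, hcolon] at hmem
      simpa [sub_eq_zero] using (hmem j).resolve_right hne
    refine ⟨fun hfi => ?_, hfj⟩
    have hone : (1 : MvPolynomial (Fin s) K) ∈ pointIdeal (P i) := by
      rw [← h, hcolon]
      intro j
      rcases eq_or_ne j i with rfl | hj
      exacts [.inr hfi, .inr (hfj j hj)]
    simp [hpoint] at hone
  · rintro ⟨hfi, hfj⟩
    ext g
    rw [hcolon, hpoint]
    refine ⟨fun h => (h i).resolve_right hfi, fun h j => ?_⟩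
    rcases eq_or_ne j i with rfl | hj
    exacts [.inl h, .inr (hfj j hj)]

theorem vNumAt_le_iff {P : Fin m → (Fin s → K)} (hP : Function.Injective P) {r : ℕ}
    (hr : RMcode P r = ⊤) (i : Fin m) (d : ℕ) :
    vNumAt (vanishingIdeal P) (pointIdeal (P i)) ≤ d ↔ Pi.single i 1 ∈ RMcode P d := by
  rw [single_mem_RMcode_iff]
  simp only [vNumAt, colon_eq_pointIdeal_iff hP]
  have hne : ∀ {f}, IsIndicator P f i → f ≠ 0 := by
    rintro _ hf rfl
    exact hf.1 (map_zero _)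
  constructor
  · intro h
    obtain ⟨f, -, hf⟩ := (single_mem_RMcode_iff P r i).1 (hr ▸ Submodule.mem_top)
    have hnonempty : {d | ∃ f : MvPolynomial (Fin s) K,
        f ≠ 0 ∧ f.totalDegree = d ∧ IsIndicator P f i}.Nonempty := ⟨_, f, hne hf, rfl, hf⟩
    obtain ⟨g, -, hg, hgi⟩ := Nat.sInf_mem hnonempty
    exact ⟨g, hg.trans_le h, hgi⟩
  · rintro ⟨f, hfd, hf⟩
    refine le_trans (Nat.sInf_le ?_) hfd
    exact ⟨f, hne hf, rfl, hf⟩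

theorem exists_mem_stdSpan_sub_mem (mo : MonomialOrder (Fin s))
    (I : Ideal (MvPolynomial (Fin s) K)) (f : MvPolynomial (Fin s) K) :
    ∃ g ∈ stdSpan mo I, f - g ∈ I := by
  obtain ⟨q, r, hfr, -, hr⟩ := mo.div_set (B := {b | b ∈ I ∧ b ≠ 0})
    (fun b hb => isUnit_iff_ne_zero.2 (mo.leadingCoeff_ne_zero_iff.2 hb.2)) f
  refine ⟨r, ?_, ?_⟩
  · rw [r.as_sum]
    refine Submodule.sum_mem _ fun a ha => ?_
    have hmon : monomial a (coeff a r) = coeff a r • monomial a (1 : K) := by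
      simp [smul_monomial]
    rw [hmon]
    refine Submodule.smul_mem _ _ (Submodule.subset_span (Set.mem_image_of_mem _ fun hmem => ?_))
    have himage : initialIdeal mo I = Ideal.span ((fun e => monomial e (1 : K)) ''
        (leadExpo mo '' {b | b ∈ I ∧ b ≠ 0})) := by
      rw [Set.image_image]
      rfl
    rw [himage, mem_ideal_span_monomial_image] at hmem
    obtain ⟨_, ⟨b, hb, rfl⟩, hle⟩ := hmem a (by simp [mem_support_iff, coeff_monomial])
    exact hr a ha b hb hle
  · rw [hfr, add_sub_cancel_right, Finsupp.linearCombination_apply]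
    exact Submodule.sum_mem _ fun b _ => I.mul_mem_left _ b.2.1

theorem exists_mem_stdSpan_evalMap_eq (P : Fin m → (Fin s → K)) (mo : MonomialOrder (Fin s))
    (f : MvPolynomial (Fin s) K) :
    ∃ g ∈ stdSpan mo (vanishingIdeal P), evalMap P g = evalMap P f := by
  obtain ⟨g, hg, hfg⟩ := exists_mem_stdSpan_sub_mem mo (vanishingIdeal P) f
  refine ⟨g, hg, funext fun i => ?_⟩
  rw [evalMap_apply, evalMap_apply]
  have := (mem_vanishingIdeal_iff_eval_eq_zero P _).1 hfg i
  rw [map_sub, sub_eq_zero] at this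
  exact this.symm

theorem dotProductBilin_nondegenerate :
    LinearMap.BilinForm.Nondegenerate (dotProductBilin K K : LinearMap.BilinForm K (Fin m → K)) :=
  ⟨fun v hv => dotProduct_eq_zero v hv,
    fun v hv => dotProduct_eq_zero v fun w => (dotProduct_comm v w).trans (hv w)⟩

theorem dotProductBilin_isRefl :
    LinearMap.BilinForm.IsRefl (dotProductBilin K K : LinearMap.BilinForm K (Fin m → K)) :=
  fun v w h => (dotProduct_comm w v).trans h

theorem dualCode_eq_orthogonal (C : Submodule K (Fin m → K)) :
    dualCode C = LinearMap.BilinForm.orthogonal (dotProductBilin K K) C := by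
  ext α
  exact forall₂_congr fun β _ => by rw [← dotProduct, dotProduct_comm]; rfl

theorem dualCode_dualCode (C : Submodule K (Fin m → K)) : dualCode (dualCode C) = C := by
  rw [dualCode_eq_orthogonal, dualCode_eq_orthogonal]
  exact LinearMap.BilinForm.orthogonal_orthogonal dotProductBilin_nondegenerate
    dotProductBilin_isRefl C

theorem finrank_add_finrank_dualCode (C : Submodule K (Fin m → K)) :
    Module.finrank K C + Module.finrank K (dualCode C) = m := by
  have hle := C.finrank_le
  have := LinearMap.BilinForm.finrank_orthogonal (dotProductBilin_nondegenerate (K := K)) C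
  rw [Module.finrank_fin_fun] at hle this
  rw [dualCode_eq_orthogonal, this]
  omega

theorem single_mem_iff_of_dualCode_eq_span {C : Submodule K (Fin m → K)} {α : Fin m → K}
    (h : dualCode C = Submodule.span K {α}) (i : Fin m) : Pi.single i 1 ∈ C ↔ α i = 0 := by
  conv_lhs => rw [← dualCode_dualCode C, h]
  constructor
  · intro hi
    have := hi α (Submodule.mem_span_singleton_self α)
    rwa [← dotProduct, single_one_dotProduct] at this
  · intro hα β hβ
    obtain ⟨c, rfl⟩ := Submodule.mem_span_singleton.1 hβ
    rw [← dotProduct, single_one_dotProduct]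
    simp [hα]

theorem RMcode_zero_ne_top (P : Fin m → (Fin s → K)) (hm : 2 ≤ m) : RMcode P 0 ≠ ⊤ := by
  intro h
  obtain ⟨f, hf, hf0, hf1⟩ := (single_mem_RMcode_iff P 0 ⟨0, by omega⟩).1 (h ▸ Submodule.mem_top)
  rw [totalDegree_eq_zero_iff_eq_C.1 (Nat.le_zero.1 hf)] at hf0 hf1
  have := hf1 ⟨1, by omega⟩ (by simp)
  simp only [eval_C] at hf0 this
  exact hf0 this

/-- `C_X(r₀-1)^⊥` is generated by the evaluation of a nowhere vanishing standard polynomial iff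
`H_I^a(r₀-1) + 1 = |X|` and all local v-numbers equal `r₀`. -/
theorem dual_one_dim_iff [Fintype K]
    (P : Fin m → (Fin s → K)) (hP : Function.Injective P) (hm : 2 ≤ m)
    (mo : MonomialOrder (Fin s)) (hmo : mo.IsGraded) (r0 : ℕ)
    (hr0 : IsLeast {ℓ : ℕ | ∀ d : ℕ, ℓ ≤ d → hilbA P d = m} r0) :
    (∃ g ∈ stdSpan mo (vanishingIdeal P),
        (∀ i : Fin m, MvPolynomial.eval (P i) g ≠ 0) ∧
        dualCode (RMcode P (r0 - 1)) = Submodule.span K {evalMap P g}) ↔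
      (hilbA P (r0 - 1) + 1 = m ∧
        ∀ i : Fin m, vNumAt (vanishingIdeal P) (pointIdeal (P i)) = r0) := by
  have htop : RMcode P r0 = ⊤ := by
    refine Submodule.eq_top_of_finrank_eq ?_
    rw [← hilbA_eq_finrank_RMcode, hr0.1 r0 le_rfl, Module.finrank_fin_fun]
  have hpos : r0 ≠ 0 := by
    rintro rfl
    exact RMcode_zero_ne_top P hm htop
  have hv : ∀ i, vNumAt (vanishingIdeal P) (pointIdeal (P i)) = r0 ↔
      Pi.single i 1 ∉ RMcode P (r0 - 1) := by
    intro i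
    have hle := (vNumAt_le_iff hP htop i r0).2 (htop ▸ Submodule.mem_top)
    rw [← vNumAt_le_iff hP htop i (r0 - 1)]
    omega
  have hdim := finrank_add_finrank_dualCode (RMcode P (r0 - 1))
  simp only [hv, hilbA_eq_finrank_RMcode]
  constructor
  · rintro ⟨g, -, hg, hdual⟩
    have hg0 : evalMap P g ≠ 0 := fun h => hg ⟨0, by omega⟩ (by rw [← evalMap_apply, h]; rfl)
    refine ⟨by rwa [hdual, finrank_span_singleton hg0] at hdim, fun i => ?_⟩
    rw [single_mem_iff_of_dualCode_eq_span hdual, evalMap_apply]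
    exact hg i
  · rintro ⟨hfin, hsingle⟩
    have hone : Module.finrank K (dualCode (RMcode P (r0 - 1))) = 1 := by omega
    obtain ⟨⟨α, hα⟩, hα0, hspan⟩ := finrank_eq_one_iff'.1 hone
    obtain ⟨f, -, rfl⟩ : α ∈ RMcode P r0 := htop ▸ Submodule.mem_top
    obtain ⟨g, hg, hgf⟩ := exists_mem_stdSpan_evalMap_eq P mo f
    rw [← hgf] at hα
    have hdual : dualCode (RMcode P (r0 - 1)) = Submodule.span K {evalMap P g} := by
      refine le_antisymm (fun β hβ => ?_) ((Submodule.span_singleton_le_iff_mem _ _).2 hα)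
      obtain ⟨c, hc⟩ := hspan ⟨β, hβ⟩
      exact Submodule.mem_span_singleton.2 ⟨c, by rw [hgf]; exact congrArg Subtype.val hc⟩
    refine ⟨g, hg, fun i hi => hsingle i ?_, hdual⟩
    rw [single_mem_iff_of_dualCode_eq_span hdual, evalMap_apply, hi]

end
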